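/- Let X be a complete Hausdorff semitopological semilattice with topology τ_X satisfying at least one of the following conditions: (1) the map (x,y) ↦ x∧y is jointly continuous; (2) X is a sequential space; (3) X admits an injective continuous map to a T2δ-space; (4) X is functionally Hausdorff. Then 𝒲_X ⊆ Λ_X ⊆ 𝒵_X ⊆ τ_X, where 𝒲_X is the I-weak topology, Λ_X the Lawson topology, and 𝒵_X the weak• topology of X. -/

import Mathlib

open Set TopologicalSpace

variable (X : Type*)

/-- The weak• topology `𝒵_X` of a topologized semilattice: generated by the subbase of
complements of closed subsemilattices. -/
def zarTop [SemilatticeInf X] [TopologicalSpace X] : TopologicalSpace X :=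
  TopologicalSpace.generateFrom
    {U : Set X | ∃ S : Set X, IsClosed S ∧ (∀ a ∈ S, ∀ b ∈ S, a ⊓ b ∈ S) ∧ U = Sᶜ}

/-- The weak° topology `η_X` of a topologized semilattice: generated by the base of
open subsemilattices. -/
def etaTop [SemilatticeInf X] [TopologicalSpace X] : TopologicalSpace X :=
  TopologicalSpace.generateFrom
    {U : Set X | IsOpen U ∧ ∀ a ∈ U, ∀ b ∈ U, a ⊓ b ∈ U}

/-- The `𝕀`-weak topology `𝒲_X`: generated by the subbase of preimages of open subsets of
`[0,1]` under continuous homomorphisms `h : X → ([0,1], min)`. -/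
def iweakTop [SemilatticeInf X] [TopologicalSpace X] : TopologicalSpace X :=
  TopologicalSpace.generateFrom
    {V : Set X | ∃ h : X → unitInterval, Continuous h ∧
      (∀ x y : X, h (x ⊓ y) = min (h x) (h y)) ∧
      ∃ U : Set unitInterval, IsOpen U ∧ V = h ⁻¹' U}

/-- `U` is Scott-open: `U = ↑U` and every nonempty up-directed set whose supremum lies in
`U` meets `U`. -/
def ScottOpen [Preorder X] (U : Set X) : Prop :=
  IsUpperSet U ∧ ∀ D : Set X, D.Nonempty → DirectedOn (· ≤ ·) D →
    ∀ a : X, IsLUB D a → a ∈ U → (D ∩ U).Nonempty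

/-- The Lawson topology `Λ_X`: generated by the subbase consisting of Scott-open sets and
complements of upper sets `↑x`. -/
def lawsonTop [Preorder X] : TopologicalSpace X :=
  TopologicalSpace.generateFrom
    ({U : Set X | ScottOpen X U} ∪ {V : Set X | ∃ x : X, V = (Set.Ici x)ᶜ})

/-- The interval topology: generated by the subbase of complements of the sets `↑x`, `↓x`. -/
def intervalTop [Preorder X] : TopologicalSpace X :=
  TopologicalSpace.generateFrom
    ({V : Set X | ∃ x : X, V = (Set.Ici x)ᶜ} ∪ {V : Set X | ∃ x : X, V = (Set.Iic x)ᶜ})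

/-- A topologized semilattice is complete if every nonempty chain `C` has an infimum and a
supremum in `X`, both belonging to the closure of `C`. -/
def CompleteTS [SemilatticeInf X] [TopologicalSpace X] : Prop :=
  ∀ C : Set X, C.Nonempty → IsChain (· ≤ ·) C →
    (∃ a : X, IsGLB C a ∧ a ∈ closure C) ∧ (∃ b : X, IsLUB C b ∧ b ∈ closure C)

/-- A T2δ-space: a T1 space in which every point of an open set `U` has a countable family
of closed neighborhoods whose intersection is contained in `U`. -/
def T2DeltaSpace (Y : Type*) [TopologicalSpace Y] : Prop :=
  T1Space Y ∧ ∀ U : Set Y, IsOpen U → ∀ y ∈ U,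
    ∃ 𝒰 : Set (Set Y), 𝒰.Countable ∧ (∀ A ∈ 𝒰, IsClosed A ∧ A ∈ nhds y) ∧ ⋂₀ 𝒰 ⊆ U

universe u

open Cardinal in
/-- Every type is equivalent to a well-ordered type whose proper initial segments have smaller
cardinality. -/
theorem exists_wellOrder_mk_Iio_lt (S : Type u) :
    ∃ (κ : Type u) (_ : LinearOrder κ) (_ : WellFoundedLT κ) (_ : κ ≃ S),
      (∀ i : κ, #(Set.Iio i) < #S) ∧ (Infinite S → NoMaxOrder κ) := by
  have hmk : #((#S).ord.ToType) = #S := mk_ord_toType _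
  obtain ⟨e⟩ := Cardinal.eq.1 hmk
  exact ⟨_, inferInstance, inferInstance, e, fun i => (mk_Iio_lt i (by simp)).trans_eq hmk,
    fun h => Cardinal.noMaxOrder (by simp)⟩

open Cardinal in
theorem exists_isLUB_image_finset {ι P : Type*} [PartialOrder P] {C : Set P}
    (hC : ∀ T ⊆ C, T.Nonempty → IsChain (· ≤ ·) T → ∃ b ∈ C, IsLUB T b)
    {g : Finset ι → P} (hg : Monotone g) (hgC : ∀ A, g A ∈ C) (S : Set ι) :
    ∃ b ∈ C, IsLUB (g '' {A | ↑A ⊆ S}) b := by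
  induction hc : #S using WellFoundedLT.induction generalizing S with
  | ind c ih =>
    subst hc
    rcases S.finite_or_infinite with hfin | hinf
    · refine ⟨g hfin.toFinset, hgC _, IsGreatest.isLUB ⟨⟨_, by simp, rfl⟩, ?_⟩⟩
      rintro _ ⟨A, hA, rfl⟩
      exact hg fun a ha => by simpa using hA ha
    · obtain ⟨κ, _, _, e, hκ, hmax⟩ := exists_wellOrder_mk_Iio_lt S
      let T : κ → Set ι := fun i => (fun j => (e j : ι)) '' Set.Iio i
      have hTS : ∀ i, T i ⊆ S := by
        rintro i _ ⟨j, -, rfl⟩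
        exact (e j).2
      have hTmono : Monotone T := fun i j hij => Set.image_mono (Set.Iio_subset_Iio hij)
      have hT : ∀ i, #(T i) < #S := fun i =>
        mk_image_le.trans_lt (hκ i)
      choose b hbC hb using fun i => ih _ (hT i) (T i) rfl
      have hbmono : Monotone b := fun i j hij =>
        (hb i).mono (hb j) (Set.image_mono fun A hA => hA.trans (hTmono hij))
      have : Infinite S := hinf.to_subtype
      have hne : Nonempty κ := ⟨e.symm (Classical.arbitrary S)⟩
      have := hmax ‹_›
      obtain ⟨s, hsC, hs⟩ := hC (Set.range b) (by rintro _ ⟨i, rfl⟩; exact hbC i)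
        (Set.range_nonempty _) hbmono.isChain_range
      refine ⟨s, hsC, ?_, ?_⟩
      · rintro _ ⟨A, hA, rfl⟩
        obtain ⟨i, hi⟩ : ∃ i, (A : Set ι) ⊆ T i := by
          have hfin : {j | (e j : ι) ∈ A}.Finite :=
            A.finite_toSet.preimage (Subtype.val_injective.comp e.injective).injOn
          obtain ⟨m, hm⟩ := hfin.bddAbove
          obtain ⟨i, hi⟩ := exists_gt m
          refine ⟨i, fun a ha => ⟨e.symm ⟨a, hA ha⟩, ?_, by simp⟩⟩
          exact lt_of_le_of_lt (hm (by simpa using ha)) hi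
        exact ((hb i).1 ⟨A, hi, rfl⟩).trans (hs.1 ⟨i, rfl⟩)
      · intro u hu
        refine hs.2 ?_
        rintro _ ⟨i, rfl⟩
        exact (hb i).2 fun x ⟨A, hA, hx⟩ => hu ⟨A, hA.trans (hTS i), hx⟩

/-- Dependent choice along a well-founded relation. -/
theorem WellFounded.exists_choice {ι β : Type*} {r : ι → ι → Prop} (wf : WellFounded r)
    (R : (i : ι) → ((j : ι) → r j i → β) → β → Prop) (h : ∀ i f, ∃ p, R i f p) :
    ∃ y : ι → β, ∀ i, R i (fun j _ => y j) (y i) := by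
  choose F hF using h
  refine ⟨wf.fix F, fun i => ?_⟩
  rw [wf.fix_eq]
  exact hF i _

/-- In a nonempty directed order, upper bounds of finite sets can be chosen monotonically. -/
theorem exists_monotone_finset_upperBound (α : Type*) [PartialOrder α] [IsDirectedOrder α]
    [Nonempty α] : ∃ g : Finset α → α, Monotone g ∧ ∀ a, a ≤ g {a} := by
  classical
  obtain ⟨g, hg⟩ := WellFounded.exists_choice (β := α) (Finset.lt_wf (α := α))
    (fun A f p => (∀ B h, f B h ≤ p) ∧ ∀ a ∈ A, a ≤ p) (fun A f => by
      obtain ⟨p, hp⟩ : ∃ p, ∀ i ∈ A ∪ A.ssubsets.attach.image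
        (fun B : A.ssubsets => f B.1 (Finset.mem_ssubsets.1 B.2)), i ≤ p := Finset.exists_le _
      refine ⟨p, fun B h => hp _ (Finset.mem_union_right _ (Finset.mem_image.2 ?_)),
        fun a ha => hp a (Finset.mem_union_left _ ha)⟩
      exact ⟨⟨B, Finset.mem_ssubsets.2 h⟩, Finset.mem_attach _ _, rfl⟩)
  refine ⟨g, fun A B hAB => ?_, fun a => (hg _).2 a (Finset.mem_singleton_self a)⟩
  rcases hAB.eq_or_lt with rfl | h
  · exact le_rfl
  · exact (hg B).1 A h

/-- A set closed under suprema of nonempty chains is closed under suprema of nonempty directed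
sets. -/
theorem DirectedOn.exists_isLUB_mem_of_chain {P : Type*} [PartialOrder P] {C D : Set P}
    (hC : ∀ T ⊆ C, T.Nonempty → IsChain (· ≤ ·) T → ∃ b ∈ C, IsLUB T b)
    (hDC : D ⊆ C) (hne : D.Nonempty) (hD : DirectedOn (· ≤ ·) D) : ∃ b ∈ C, IsLUB D b := by
  have := hne.to_subtype
  have : IsDirectedOrder D := ⟨fun a b => by
    obtain ⟨c, hc, hac, hbc⟩ := hD a a.2 b b.2
    exact ⟨⟨c, hc⟩, hac, hbc⟩⟩
  obtain ⟨g, hg, hle⟩ := exists_monotone_finset_upperBound D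
  obtain ⟨b, hbC, hb⟩ := exists_isLUB_image_finset hC (g := fun A => (g A : P))
    (fun A B h => hg h) (fun A => hDC (g A).2) Set.univ
  refine ⟨b, hbC, fun d hd => ?_, fun u hu => hb.2 ?_⟩
  · exact le_trans (show d ≤ g {⟨d, hd⟩} from hle ⟨d, hd⟩) (hb.1 ⟨_, by simp, rfl⟩)
  · rintro _ ⟨A, -, rfl⟩
    exact hu (g A).2

section Selection

variable {X : Type*} [SemilatticeInf X]

theorem infClosure_insert_subset (p : X) (A : Set X) :
    infClosure (insert p A) ⊆ insert p (infClosure A ∪ (· ⊓ p) '' infClosure A) := by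
  have hsub : A ⊆ infClosure A := subset_infClosure
  have hinf : InfClosed (infClosure A) := infClosed_infClosure
  refine infClosure_min (Set.insert_subset_insert (hsub.trans Set.subset_union_left)) ?_
  rintro a (rfl | ha | ⟨e, he, rfl⟩) b (rfl | hb | ⟨f, hf, rfl⟩)
  · simp
  · exact Or.inr (Or.inr ⟨b, hb, inf_comm _ _⟩)
  · exact Or.inr (Or.inr ⟨f, hf, by simp [inf_comm]⟩)
  · exact Or.inr (Or.inr ⟨a, ha, rfl⟩)
  · exact Or.inr (Or.inl (hinf ha hb))
  · exact Or.inr (Or.inr ⟨_, hinf ha hf, by simp [inf_assoc]⟩)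
  · exact Or.inr (Or.inr ⟨e, he, by simp⟩)
  · exact Or.inr (Or.inr ⟨_, hinf he hb, by simp [inf_comm, inf_left_comm]⟩)
  · exact Or.inr (Or.inr ⟨_, hinf he hf, by simp [inf_comm, inf_left_comm]⟩)

theorem exists_mem_infClosure_image_Icc {ι : Type*} [LinearOrder ι] (y : ι → X) {I : Set ι} {β : ι}
    (hI : I ⊆ Set.Ici β) {e : X} (he : e ∈ infClosure (y '' I)) :
    ∃ γ ∈ I, e ∈ infClosure (y '' Set.Icc β γ) := by
  have hmono : ∀ {γ δ : ι}, γ ≤ δ → infClosure (y '' Set.Icc β γ) ⊆ infClosure (y '' Set.Icc β δ) :=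
    fun h => infClosure_mono (Set.image_mono (Set.Icc_subset_Icc_right h))
  refine infClosure_min (t := {e | ∃ γ ∈ I, e ∈ infClosure (y '' Set.Icc β γ)}) ?_ ?_ he
  · rintro _ ⟨γ, hγ, rfl⟩
    exact ⟨γ, hγ, subset_infClosure ⟨γ, ⟨hI hγ, le_rfl⟩, rfl⟩⟩
  · rintro a ⟨γ, hγ, ha⟩ b ⟨δ, hδ, hb⟩
    rcases le_total γ δ with h | h
    · exact ⟨δ, hδ, infClosed_infClosure (hmono h ha) hb⟩
    · exact ⟨γ, hγ, infClosed_infClosure ha (hmono h hb)⟩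

/-- Transfinite choice of points whose finite meets with indices at least `β` lie in `W β`. -/
theorem exists_infClosure_image_Ici_subset [Nonempty X] {ι : Type*} [LinearOrder ι]
    [WellFoundedLT ι] (W Q : ι → Set X)
    (h : ∀ (α : ι) (y : ι → X), (∀ γ < α, y γ ∈ Q γ) →
      (∀ β, infClosure (y '' Set.Ico β α) ⊆ W β) →
      ∃ p ∈ Q α, ∀ β ≤ α, p ∈ W β ∧ ∀ e ∈ infClosure (y '' Set.Ico β α), e ⊓ p ∈ W β) :
    ∃ y : ι → X, (∀ α, y α ∈ Q α) ∧ ∀ β, infClosure (y '' Set.Ici β) ⊆ W β := by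
  classical
  obtain ⟨d⟩ := ‹Nonempty X›
  let ext : (α : ι) → ((γ : ι) → γ < α → X) → ι → X := fun α f γ => if h : γ < α then f γ h else d
  obtain ⟨y, hy⟩ := WellFounded.exists_choice (β := X) (wellFounded_lt (α := ι))
    (fun α f p => (∀ γ < α, ext α f γ ∈ Q γ) →
      (∀ β, infClosure (ext α f '' Set.Ico β α) ⊆ W β) →
      p ∈ Q α ∧ ∀ β ≤ α, p ∈ W β ∧ ∀ e ∈ infClosure (ext α f '' Set.Ico β α), e ⊓ p ∈ W β)
    (fun α f => by
      by_cases h1 : (∀ γ < α, ext α f γ ∈ Q γ) ∧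
        ∀ β, infClosure (ext α f '' Set.Ico β α) ⊆ W β
      · obtain ⟨p, hp⟩ := h α (ext α f) h1.1 h1.2
        exact ⟨p, fun _ _ => hp⟩
      · exact ⟨d, fun h2 h3 => (h1 ⟨h2, h3⟩).elim⟩)
  have hext : ∀ α γ, γ < α → ext α (fun j _ => y j) γ = y γ := fun α γ hγ => dif_pos hγ
  have himg : ∀ α β, ext α (fun j _ => y j) '' Set.Ico β α = y '' Set.Ico β α := fun α β =>
    Set.image_congr fun γ hγ => hext α γ hγ.2
  simp only [himg] at hy
  have key : ∀ α, y α ∈ Q α ∧ ∀ β ≤ α, infClosure (y '' Set.Icc β α) ⊆ W β := by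
    intro α
    induction α using WellFoundedLT.induction with
    | ind α ih =>
      have hW : ∀ β, infClosure (y '' Set.Ico β α) ⊆ W β := by
        intro β e he
        obtain ⟨γ, hγ, he⟩ := exists_mem_infClosure_image_Icc y (fun γ hγ => hγ.1) he
        exact (ih γ hγ.2).2 β hγ.1 he
      obtain ⟨hQ, hp⟩ := hy α (fun γ hγ => by rw [hext α γ hγ]; exact (ih γ hγ).1) hW
      refine ⟨hQ, fun β hβ e he => ?_⟩
      rw [← Set.Ico_insert_right hβ, Set.image_insert_eq] at he
      rcases infClosure_insert_subset _ _ he with rfl | he | ⟨e, he', rfl⟩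
      · exact (hp β hβ).1
      · exact hW β he
      · exact (hp β hβ).2 e he'
  refine ⟨y, fun α => (key α).1, fun β e he => ?_⟩
  obtain ⟨γ, hγ, he⟩ := exists_mem_infClosure_image_Icc y subset_rfl he
  exact (key γ).2 β hγ he

end Selection

/-- A lower set below `x` that is closed under suprema of nonempty chains. -/
structure IsLowerChainClosed {X : Type*} [PartialOrder X] (L : Set X) (x : X) : Prop where
  lower : IsLowerSet L
  chain : ∀ T ⊆ L, T.Nonempty → IsChain (· ≤ ·) T → ∃ b ∈ L, IsLUB T b
  le : ∀ a ∈ L, a ≤ x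

theorem IsLowerSet.infClosed' {X : Type*} [SemilatticeInf X] {L : Set X} (h : IsLowerSet L) :
    InfClosed L :=
  fun _ ha _ _ => h inf_le_left ha

/-- `z` is the supremum of the infima of members of the filter `F`. -/
def IsOrderLiminf {X : Type*} [PartialOrder X] (F : Filter X) (z : X) : Prop :=
  IsLUB {a | ∃ A ∈ F, IsGLB A a} z

theorem IsOrderLiminf.mono {X : Type*} [PartialOrder X] {F G : Filter X} {z w : X}
    (hz : IsOrderLiminf F z) (hw : IsOrderLiminf G w) (h : G ≤ F) : z ≤ w :=
  IsLUB.mono hz hw fun _ ⟨A, hA, ha⟩ => ⟨A, h hA, ha⟩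

section Topology

open Filter Topology

variable {X : Type*} [SemilatticeInf X] [TopologicalSpace X]

theorem isClosed_Ici_of_continuous_inf [T2Space X] (hsemi : ∀ a : X, Continuous fun x => a ⊓ x)
    (a : X) : IsClosed (Set.Ici a) := by
  have : Set.Ici a = {x | a ⊓ x = a} := by ext; simp
  rw [this]
  exact isClosed_eq (hsemi a) continuous_const

theorem isClosed_Iic_of_continuous_inf [T2Space X] (hsemi : ∀ a : X, Continuous fun x => a ⊓ x)
    (a : X) : IsClosed (Set.Iic a) := by
  have : Set.Iic a = {x | a ⊓ x = x} := by ext; simp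
  rw [this]
  exact isClosed_eq (hsemi a) continuous_id

theorem InfClosed.closure_of_continuous_inf (hsemi : ∀ a : X, Continuous fun x => a ⊓ x)
    {M : Set X} (hM : InfClosed M) : InfClosed (closure M) := by
  have h1 : ∀ a ∈ M, ∀ b ∈ closure M, a ⊓ b ∈ closure M := fun a ha b hb =>
    map_mem_closure (hsemi a) hb fun c hc => hM ha hc
  intro a ha b hb
  rw [inf_comm, ← closure_closure]
  exact map_mem_closure (hsemi b) ha fun c hc => by rw [inf_comm]; exact h1 c hc b hb

theorem CompleteTS.exists_isLUB_mem (hcomp : CompleteTS X) {C : Set X} (hC : IsClosed C) :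
    ∀ T ⊆ C, T.Nonempty → IsChain (· ≤ ·) T → ∃ b ∈ C, IsLUB T b := by
  intro T hTC hne hT
  obtain ⟨b, hb, hbT⟩ := (hcomp T hne hT).2
  exact ⟨b, closure_minimal hTC hC hbT, hb⟩

theorem CompleteTS.exists_isLeast (hcomp : CompleteTS X) {K : Set X} (hK : IsClosed K)
    (hinf : InfClosed K) (hne : K.Nonempty) : ∃ m, IsLeast K m := by
  obtain ⟨x, hx⟩ := hne
  obtain ⟨m, -, hm⟩ := zorn_le_nonempty₀ (α := Xᵒᵈ) (OrderDual.ofDual ⁻¹' K) (by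
    intro c hcK hc y hy
    obtain ⟨a, ha, hac⟩ := (hcomp (OrderDual.toDual ⁻¹' c) ⟨_, hy⟩ hc.symm).1
    exact ⟨OrderDual.toDual a, closure_minimal hcK hK hac, fun z hz => ha.1 hz⟩)
    (OrderDual.toDual x) hx
  refine ⟨OrderDual.ofDual m, hm.1, fun a ha => ?_⟩
  have : OrderDual.ofDual m ≤ OrderDual.ofDual m ⊓ a :=
    hm.2 (y := OrderDual.toDual (OrderDual.ofDual m ⊓ a)) (hinf hm.1 ha)
      (show OrderDual.ofDual m ⊓ a ≤ OrderDual.ofDual m from inf_le_left)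
  exact this.trans inf_le_right

theorem IsLowerChainClosed.exists_seq {L : Set X} {x : X} (hL : IsLowerChainClosed L x)
    (hsemi : ∀ a : X, Continuous fun x => a ⊓ x) {B U : ℕ → Set X} (hBL : ∀ n, B n ⊆ L)
    (hB : ∀ n, ∃ᶠ a in 𝓝 x, a ∈ B n) (hU : ∀ n, IsOpen (U n)) (hxU : ∀ n, x ∈ U n) :
    ∃ y : ℕ → X, (∀ n, y n ∈ B n) ∧ ∀ n, infClosure (y '' Set.Ici n) ⊆ U n := by
  have : Nonempty X := ⟨x⟩
  refine exists_infClosure_image_Ici_subset U B fun α y hy hW => ?_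
  have hev : ∀ᶠ p in 𝓝 x, ∀ β ∈ Set.Iic α,
      p ∈ U β ∧ ∀ e ∈ infClosure (y '' Set.Ico β α), e ⊓ p ∈ U β := by
    refine (eventually_all_finite (Set.finite_Iic α)).2 fun β hβ => ?_
    refine Filter.Eventually.and ((hU β).mem_nhds (hxU β)) ?_
    refine (eventually_all_finite ((Set.finite_Ico β α).image y).infClosure).2 fun e he => ?_
    have heL : e ∈ L := infClosure_min (by rintro _ ⟨γ, hγ, rfl⟩; exact hBL γ (hy γ hγ.2))
      hL.lower.infClosed' he
    have hex : e ⊓ x ∈ U β := by rw [inf_eq_left.2 (hL.le e heL)]; exact hW β he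
    exact ((hU β).preimage (hsemi e)).mem_nhds hex
  obtain ⟨p, hpB, hp⟩ := ((hB α).and_eventually hev).exists
  exact ⟨p, hpB, hp⟩

variable [T2Space X]

theorem CompleteTS.exists_isGLB_mem_closure (hcomp : CompleteTS X)
    (hsemi : ∀ a : X, Continuous fun x => a ⊓ x) {A : Set X} (hA : A.Nonempty) :
    ∃ m ∈ closure (infClosure A), IsGLB A m := by
  have hsub : A ⊆ closure (infClosure A) := subset_infClosure.trans subset_closure
  obtain ⟨m, hm⟩ := hcomp.exists_isLeast isClosed_closure
    (infClosed_infClosure (s := A) |>.closure_of_continuous_inf hsemi) (hA.mono hsub)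
  refine ⟨m, hm.1, fun a ha => hm.2 (hsub ha), fun l hl => ?_⟩
  have : closure (infClosure A) ⊆ Set.Ici l :=
    closure_minimal (infClosure_min (fun a ha => hl ha) fun a ha b hb => le_inf ha hb)
      (isClosed_Ici_of_continuous_inf hsemi l)
  exact this hm.1

theorem CompleteTS.directedOn_isGLB (hcomp : CompleteTS X)
    (hsemi : ∀ a : X, Continuous fun x => a ⊓ x) (F : Filter X) [F.NeBot] (S : Set X) :
    DirectedOn (· ≤ ·) {a | ∃ A ∈ F, A ⊆ S ∧ IsGLB A a} := by
  rintro a ⟨A, hA, hAS, ha⟩ b ⟨B, hB, -, hb⟩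
  have hAB := inter_mem hA hB
  obtain ⟨c, -, hc⟩ := hcomp.exists_isGLB_mem_closure hsemi (nonempty_of_mem hAB)
  exact ⟨c, ⟨_, hAB, Set.inter_subset_left.trans hAS, hc⟩, hc.mono ha Set.inter_subset_left,
    hc.mono hb Set.inter_subset_right⟩

theorem CompleteTS.exists_isOrderLiminf (hcomp : CompleteTS X)
    (hsemi : ∀ a : X, Continuous fun x => a ⊓ x) {L : Set X} {x : X} (hL : IsLowerChainClosed L x)
    (F : Filter X) (hF : ∃ᶠ a in F, a ∈ L) : ∃ z ∈ L, IsOrderLiminf F z := by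
  have : F.NeBot :=
    (frequently_true_iff_neBot F).1 (hF.mono fun _ _ => trivial)
  have hdir := hcomp.directedOn_isGLB hsemi F Set.univ
  simp only [Set.subset_univ, true_and] at hdir
  refine DirectedOn.exists_isLUB_mem_of_chain hL.chain ?_ ?_ hdir
  · rintro a ⟨A, hA, ha⟩
    obtain ⟨b, hbL, hbA⟩ := (hF.and_eventually hA).exists
    exact hL.lower (ha.1 hbA) hbL
  · obtain ⟨a, -, ha⟩ := hcomp.exists_isGLB_mem_closure hsemi (nonempty_of_mem (univ_mem (f := F)))
    exact ⟨a, _, univ_mem, ha⟩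

theorem IsOrderLiminf.mem_of_infClosure_subset {F : Filter X} [F.NeBot] {z : X}
    (hz : IsOrderLiminf F z) (hcomp : CompleteTS X) (hsemi : ∀ a : X, Continuous fun x => a ⊓ x)
    {A C : Set X} (hA : A ∈ F) (hC : IsClosed C) (hAC : infClosure A ⊆ C) : z ∈ C := by
  obtain ⟨w, hwC, hw⟩ := DirectedOn.exists_isLUB_mem_of_chain (hcomp.exists_isLUB_mem hC)
    (D := {a | ∃ B ∈ F, B ⊆ A ∧ IsGLB B a}) (by
      rintro a ⟨B, hB, hBA, ha⟩
      obtain ⟨b, hb, hbB⟩ := hcomp.exists_isGLB_mem_closure hsemi (nonempty_of_mem hB)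
      rw [ha.unique hbB]
      exact closure_minimal ((infClosure_mono hBA).trans hAC) hC hb)
    (by
      obtain ⟨a, -, ha⟩ := hcomp.exists_isGLB_mem_closure hsemi (nonempty_of_mem hA)
      exact ⟨a, A, hA, subset_rfl, ha⟩)
    (hcomp.directedOn_isGLB hsemi F A)
  have : z = w := by
    refine le_antisymm (hz.2 ?_) (hw.2 ?_)
    · rintro a ⟨B, hB, ha⟩
      have hBA := inter_mem hB hA
      obtain ⟨b, -, hb⟩ := hcomp.exists_isGLB_mem_closure hsemi (nonempty_of_mem hBA)
      exact (hb.mono ha Set.inter_subset_left).trans (hw.1 ⟨_, hBA, Set.inter_subset_right, hb⟩)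
    · rintro a ⟨B, hB, -, ha⟩
      exact hz.1 ⟨B, hB, ha⟩
  rwa [this]

theorem IsLowerChainClosed.exists_mem_closure {L : Set X} {x : X} (hL : IsLowerChainClosed L x)
    (hcomp : CompleteTS X) (hsemi : ∀ a : X, Continuous fun x => a ⊓ x) (hx : x ∈ closure L)
    {U : ℕ → Set X} (hU : ∀ n, IsOpen (U n)) (hxU : ∀ n, x ∈ U n) :
    ∃ z ∈ L, ∀ n, z ∈ closure (U n) := by
  obtain ⟨y, hyL, hy⟩ := hL.exists_seq hsemi (B := fun _ => L) (fun _ => subset_rfl)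
    (fun _ => mem_closure_iff_frequently.1 hx) hU hxU
  obtain ⟨z, hzL, hz⟩ := hcomp.exists_isOrderLiminf hsemi hL (map y atTop)
    (Frequently.of_forall (f := atTop) hyL)
  exact ⟨z, hzL, fun n => hz.mem_of_infClosure_subset hcomp hsemi (image_mem_map (Ici_mem_atTop n))
    isClosed_closure ((hy n).trans subset_closure)⟩

theorem eq_of_forall_isOpen_mem_closure {X : Type*} [TopologicalSpace X] [T2Space X] {x z : X}
    (h : ∀ U : Set X, IsOpen U → x ∈ U → z ∈ closure U) : z = x := by
  by_contra hne
  obtain ⟨u, v, hu, hv, hzu, hxv, huv⟩ := t2_separation hne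
  exact Set.disjoint_left.1 (huv.closure_right hu) hzu (h v hv hxv)

/-- The case of jointly continuous meets. -/
theorem IsLowerChainClosed.mem_of_continuous_inf {L : Set X} {x : X} (hL : IsLowerChainClosed L x)
    (hcomp : CompleteTS X) (hinf : Continuous fun p : X × X => p.1 ⊓ p.2) (hx : x ∈ closure L) :
    x ∈ L := by
  have hsemi : ∀ a : X, Continuous fun x => a ⊓ x := fun a =>
    hinf.comp (continuous_const.prodMk continuous_id)
  let S : Set (ℕ → Set X) := {U | ∀ n, IsOpen (U n) ∧ x ∈ U n ∧
    ∀ a ∈ U (n + 1), ∀ b ∈ U (n + 1), a ⊓ b ∈ U n}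
  let K : (ℕ → Set X) → Set X := fun U => ⋂ n, closure (U n)
  have hSinter : ∀ U ∈ S, ∀ V ∈ S, (fun n => U n ∩ V n) ∈ S := fun U hU V hV n =>
    ⟨(hU n).1.inter (hV n).1, ⟨(hU n).2.1, (hV n).2.1⟩, fun a ha b hb =>
      ⟨(hU n).2.2 a ha.1 b hb.1, (hV n).2.2 a ha.2 b hb.2⟩⟩
  have hKmono : ∀ U V : ℕ → Set X, (∀ n, U n ⊆ V n) → K U ⊆ K V := fun U V h =>
    Set.iInter_mono fun n => closure_mono (h n)
  have hKinf : ∀ U ∈ S, InfClosed (K U) := by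
    intro U hU a ha b hb
    rw [Set.mem_iInter] at ha hb ⊢
    exact fun n => map_mem_closure₂ hinf (ha (n + 1)) (hb (n + 1)) (hU n).2.2
  have hKclosed : ∀ U, IsClosed (K U) := fun U => isClosed_iInter fun n => isClosed_closure
  have hKL : ∀ U ∈ S, ∃ z ∈ L, z ∈ K U := by
    intro U hU
    obtain ⟨z, hzL, hz⟩ := hL.exists_mem_closure hcomp hsemi hx (fun n => (hU n).1)
      fun n => (hU n).2.1
    exact ⟨z, hzL, Set.mem_iInter.2 hz⟩
  have hSopen : ∀ V : Set X, IsOpen V → x ∈ V → ∃ U ∈ S, U 0 = V := by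
    intro V hV hxV
    have step : ∀ W : {W : Set X // IsOpen W ∧ x ∈ W}, ∃ W' : {W : Set X // IsOpen W ∧ x ∈ W},
        ∀ a ∈ W'.1, ∀ b ∈ W'.1, a ⊓ b ∈ W.1 := by
      rintro ⟨W, hW, hxW⟩
      have hmem : (fun p : X × X => p.1 ⊓ p.2) ⁻¹' W ∈ 𝓝 (x, x) :=
        (hW.preimage hinf).mem_nhds (by simpa using hxW)
      obtain ⟨u, hu, hxu, huW⟩ := exists_nhds_square hmem
      exact ⟨⟨u, hu, hxu⟩, fun a ha b hb => huW (Set.mk_mem_prod ha hb)⟩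
    choose f hf using step
    let U : ℕ → {W : Set X // IsOpen W ∧ x ∈ W} := fun n => f^[n] ⟨V, hV, hxV⟩
    refine ⟨fun n => (U n).1, fun n => ⟨(U n).2.1, (U n).2.2, ?_⟩, rfl⟩
    have : U (n + 1) = f (U n) := Function.iterate_succ_apply' f n _
    simp only [this]
    exact hf (U n)
  let F : Filter X :=
    { sets := {A | ∃ U ∈ S, K U ⊆ A}
      univ_sets := by
        obtain ⟨U, hU, -⟩ := hSopen Set.univ isOpen_univ trivial
        exact ⟨U, hU, Set.subset_univ _⟩
      sets_of_superset := fun ⟨U, hU, hUA⟩ hAB => ⟨U, hU, hUA.trans hAB⟩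
      inter_sets := by
        rintro A B ⟨U, hU, hUA⟩ ⟨V, hV, hVB⟩
        exact ⟨_, hSinter U hU V hV, Set.subset_inter
          ((hKmono _ _ fun n => Set.inter_subset_left).trans hUA)
          ((hKmono _ _ fun n => Set.inter_subset_right).trans hVB)⟩ }
  have hF : ∃ᶠ a in F, a ∈ L := by
    rintro ⟨U, hU, hUL⟩
    obtain ⟨z, hzL, hzU⟩ := hKL U hU
    exact hUL hzU hzL
  have : F.NeBot := (frequently_true_iff_neBot F).1 (hF.mono fun _ _ => trivial)
  obtain ⟨z, hzL, hz⟩ := hcomp.exists_isOrderLiminf hsemi hL F hF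
  have hzx : z = x := eq_of_forall_isOpen_mem_closure fun V hV hxV => by
    obtain ⟨U, hU, rfl⟩ := hSopen V hV hxV
    have : z ∈ K U := hz.mem_of_infClosure_subset hcomp hsemi ⟨U, hU, subset_rfl⟩ (hKclosed U)
      (hKinf U hU).infClosure_eq.subset
    exact Set.mem_iInter.1 this 0
  rwa [← hzx]

/-- In a sequential space a chain whose countable subsets are bounded in it has a greatest
element. -/
theorem CompleteTS.exists_isGreatest_of_countable_bounded [SequentialSpace X]
    (hcomp : CompleteTS X) (hsemi : ∀ a : X, Continuous fun x => a ⊓ x) {W : Set X}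
    (hne : W.Nonempty) (hW : IsChain (· ≤ ·) W)
    (hbdd : ∀ T ⊆ W, T.Countable → ∃ w ∈ W, ∀ t ∈ T, t ≤ w) : ∃ w, IsGreatest W w := by
  obtain ⟨b, hb, hbW⟩ := (hcomp W hne hW).2
  let C : Set X := {c | ∃ w ∈ W, c ∈ closure (W ∩ Set.Iic w)}
  have hC : IsClosed C := by
    refine IsSeqClosed.isClosed fun c p hc hp => ?_
    choose w hwW hw using hc
    obtain ⟨v, hvW, hv⟩ := hbdd (Set.range w) (by rintro _ ⟨n, rfl⟩; exact hwW n)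
      (Set.countable_range w)
    refine ⟨v, hvW, isClosed_closure.mem_of_tendsto hp (Eventually.of_forall fun n => ?_)⟩
    exact closure_mono (Set.inter_subset_inter_right _ (Set.Iic_subset_Iic.2 (hv _ ⟨n, rfl⟩))) (hw n)
  obtain ⟨w, hwW, hw⟩ := closure_minimal
    (fun w hw => ⟨w, hw, subset_closure ⟨hw, le_rfl⟩⟩ : W ⊆ C) hC hbW
  have hbw : b ≤ w := closure_minimal Set.inter_subset_right
    (isClosed_Iic_of_continuous_inf hsemi w) hw
  exact ⟨w, hwW, fun a ha => (hb.1 ha).trans hbw⟩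

/-- The case of sequential spaces. -/
theorem IsLowerChainClosed.mem_of_tendsto [SequentialSpace X] {L : Set X} {x : X}
    (hL : IsLowerChainClosed L x) (hcomp : CompleteTS X)
    (hsemi : ∀ a : X, Continuous fun x => a ⊓ x) {u : ℕ → X} (huL : ∀ n, u n ∈ L)
    (hu : Tendsto u atTop (𝓝 x)) : x ∈ L := by
  let P := {F : Filter X // F.NeBot ∧ F.IsCountablyGenerated ∧ F ≤ 𝓝 x ∧ L ∈ F}
  have hlim : ∀ F : P, ∃ z ∈ L, IsOrderLiminf F.1 z := fun F =>
    have := F.2.1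
    hcomp.exists_isOrderLiminf hsemi hL F.1 (Eventually.frequently F.2.2.2.2)
  choose z hzL hz using hlim
  have hzmono : ∀ F G : P, G.1 ≤ F.1 → z F ≤ z G := fun F G h => (hz F).mono (hz G) h
  let r : P → P → Prop := fun F G => F = G ∨ G.1 ≤ F.1 ∧ z F < z G
  have hrle : ∀ {F G}, r F G → G.1 ≤ F.1 := by
    rintro F G (rfl | h)
    exacts [le_rfl, h.1]
  have hrz : ∀ {F G}, r F G → z F ≤ z G := fun h => hzmono _ _ (hrle h)
  obtain ⟨M, hM⟩ : ∃ M, ∀ G, r M G → r G M := by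
    refine exists_maximal_of_chains_bounded (fun c hc => ?_) ?_
    · rcases c.eq_empty_or_nonempty with rfl | hne
      · refine ⟨⟨map u atTop, inferInstance, inferInstance, hu, ?_⟩, by simp⟩
        exact mem_map.2 (univ_mem' huL)
      have htot : ∀ F ∈ c, ∀ G ∈ c, r F G ∨ r G F := fun F hF G hG => by
        by_cases h : F = G
        · exact Or.inl (Or.inl h)
        · exact hc hF hG h
      have hzc : IsChain (· ≤ ·) (z '' c) := by
        rintro _ ⟨F, hF, rfl⟩ _ ⟨G, hG, rfl⟩ -
        exact (htot F hF G hG).imp hrz hrz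
      have hmax : ∀ F ∈ c, (∀ G ∈ c, z G ≤ z F) → ∀ G ∈ c, r G F := fun F hF h G hG => by
        rcases htot G hG F hF with h' | rfl | h'
        · exact h'
        · exact Or.inl rfl
        · exact (h'.2.not_ge (h G hG)).elim
      by_cases hbdd : ∀ T ⊆ z '' c, T.Countable → ∃ w ∈ z '' c, ∀ t ∈ T, t ≤ w
      · obtain ⟨_, ⟨F, hF, rfl⟩, hw⟩ :=
          hcomp.exists_isGreatest_of_countable_bounded hsemi (hne.image z) hzc hbdd
        exact ⟨F, hmax F hF fun G hG => hw ⟨G, hG, rfl⟩⟩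
      · push Not at hbdd
        obtain ⟨T, hTc, hT, hTub⟩ := hbdd
        obtain ⟨T, hTc', rfl, hT'⟩ : ∃ T' ⊆ c, z '' T' = T ∧ T'.Countable := by
          have : Nonempty P := ⟨hne.some⟩
          choose! g hgc hg using hTc
          have hgT : z '' (g '' T) = T := by
            rw [Set.image_image]
            exact (Set.image_congr hg).trans (Set.image_id' T)
          exact ⟨g '' T, by rintro _ ⟨t, ht, rfl⟩; exact hgc ht, hgT, hT.image g⟩
        have hcof : ∀ F ∈ c, ∃ G ∈ T, r F G := fun F hF => by
          obtain ⟨_, ⟨G, hG, rfl⟩, hGF⟩ := hTub (z F) ⟨F, hF, rfl⟩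
          exact ⟨G, hG, (htot F hF G (hTc' hG)).resolve_right fun h => hGF (hrz h)⟩
        have hTne : Nonempty T := by
          obtain ⟨F, hF⟩ := hne
          obtain ⟨G, hG, -⟩ := hcof F hF
          exact ⟨⟨G, hG⟩⟩
        have hTcount : Countable T := hT'.to_subtype
        let I : Filter X := ⨅ G : T, G.1.1
        have hI : I.NeBot := by
          refine iInf_neBot_of_directed' ?_ fun G => G.1.2.1
          intro F G
          rcases htot F.1 (hTc' F.2) G.1 (hTc' G.2) with h | h
          exacts [⟨G, hrle h, le_rfl⟩, ⟨F, le_rfl, hrle h⟩]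
        have hIc : I.IsCountablyGenerated :=
          have : ∀ G : T, G.1.1.IsCountablyGenerated := fun G => G.1.2.2.1
          Filter.iInf.isCountablyGenerated _
        have hIle : ∀ G ∈ T, I ≤ G.1 := fun G hG => iInf_le (fun G : T => G.1.1) ⟨G, hG⟩
        obtain ⟨⟨G₀, hG₀⟩⟩ := hTne
        let J : P := ⟨I, hI, hIc, (hIle G₀ hG₀).trans G₀.2.2.2.1, hIle G₀ hG₀ G₀.2.2.2.2⟩
        by_cases hlt : ∀ F ∈ c, z F < z J
        · refine ⟨J, fun F hF => Or.inr ⟨?_, hlt F hF⟩⟩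
          obtain ⟨G, hG, hFG⟩ := hcof F hF
          exact (hIle G hG).trans (hrle hFG)
        · push Not at hlt
          obtain ⟨F, hF, hFJ⟩ := hlt
          refine ⟨F, hmax F hF fun G hG => ?_⟩
          obtain ⟨G', hG', hGG'⟩ := hcof G hG
          have h1 : z G' ≤ z J := hzmono G' J (hIle G' hG')
          have h2 : z F ≤ z J := by
            obtain ⟨F', hF', hFF'⟩ := hcof F hF
            exact (hrz hFF').trans (hzmono F' J (hIle F' hF'))
          exact (hrz hGG').trans (h1.trans (eq_of_le_of_not_lt h2 hFJ).ge)
    · rintro F G H (rfl | h) (rfl | h')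
      · exact Or.inl rfl
      · exact Or.inr h'
      · exact Or.inr h
      · exact Or.inr ⟨h'.1.trans h.1, h.2.trans h'.2⟩
  have hMeq : ∀ G : P, G.1 ≤ M.1 → z G = z M := fun G hG => by
    by_contra hne
    have hlt : z M < z G := lt_of_le_of_ne (hzmono M G hG) (Ne.symm hne)
    exact hlt.not_ge (hrz (hM G (Or.inr ⟨hG, hlt⟩)))
  obtain ⟨hMne, hMc, hMx, hML⟩ := M.2
  have hzx : z M = x := eq_of_forall_isOpen_mem_closure fun U hU hxU => by
    obtain ⟨B, hB⟩ := M.1.exists_antitone_basis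
    obtain ⟨y, hyB, hy⟩ := hL.exists_seq hsemi (B := fun n => B n ∩ L) (U := fun _ => U)
      (fun n => Set.inter_subset_right)
      (fun n => (Eventually.frequently (inter_mem (hB.mem n) hML)).filter_mono hMx)
      (fun _ => hU) fun _ => hxU
    have hyM : Tendsto y atTop M.1 := hB.tendsto fun n => (hyB n).1
    let G : P := ⟨map y atTop, inferInstance, inferInstance, hyM.trans hMx,
      mem_map.2 (univ_mem' fun n => (hyB n).2)⟩
    rw [← hMeq G hyM]
    exact (hz G).mem_of_infClosure_subset hcomp hsemi (image_mem_map (Ici_mem_atTop 0))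
      isClosed_closure ((hy 0).trans subset_closure)
  rw [← hzx]
  exact hzL M

open Cardinal in
theorem mk_infClosure_lt {X : Type u} [SemilatticeInf X] {s : Set X} {c : Cardinal.{u}}
    (hc : ℵ₀ < c) (hs : #s < c) : #(infClosure s) < c := by
  let f : s × List s → X := fun p => (p.2.map Subtype.val).foldr (· ⊓ ·) p.1
  have hfoldr : ∀ (l : List X) (a b : X), l.foldr (· ⊓ ·) a ⊓ b = l.foldr (· ⊓ ·) (a ⊓ b) := by
    intro l a b
    induction l with
    | nil => rfl
    | cons d l ih => simp [inf_assoc, ih]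
  have hsub : infClosure s ⊆ Set.range f := by
    refine infClosure_min (fun a ha => ⟨(⟨a, ha⟩, []), rfl⟩) ?_
    rintro _ ⟨⟨a, l⟩, rfl⟩ _ ⟨⟨b, m⟩, rfl⟩
    exact ⟨(b, l ++ a :: m), by simp [f, hfoldr]⟩
  refine ((mk_le_mk_of_subset hsub).trans mk_range_le).trans_lt ?_
  rw [mk_prod, lift_id, lift_id]
  exact mul_lt_of_lt hc.le hs ((mk_list_le_max s).trans_lt (max_lt hc hs))

open Cardinal in
theorem IsLowerChainClosed.exists_forall_mem {X : Type u} [SemilatticeInf X] [TopologicalSpace X]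
    [T2Space X] {L : Set X} {x : X} (hL : IsLowerChainClosed L x) (hcomp : CompleteTS X)
    (hsemi : ∀ a : X, Continuous fun x => a ⊓ x) (hx : x ∈ closure L) {𝒱 : Set (Set X)}
    (hopen : ∀ V ∈ 𝒱, IsOpen V ∧ x ∈ V)
    (hclosed : ∀ V ∈ 𝒱, ∃ v : ℕ → Set X, (∀ n, v n ∈ 𝒱) ∧ ⋂ n, closure (v n) ⊆ V)
    (hinf : ∀ V ∈ 𝒱, ∀ e ∈ V, e ≤ x → (e ⊓ ·) ⁻¹' V ∈ 𝒱) {𝒮 : Set (Set X)} (h𝒮 : 𝒮 ⊆ 𝒱) :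
    ∃ z ∈ L, ∀ V ∈ 𝒮, z ∈ V := by
  choose! v hv hvV using hclosed
  induction hc : #𝒮 using WellFoundedLT.induction generalizing 𝒮 with
  | ind c ih =>
    subst hc
    have : Nonempty X := ⟨x⟩
    by_cases hcount : 𝒮.Countable
    · rcases 𝒮.eq_empty_or_nonempty with rfl | hne
      · obtain ⟨z, hz⟩ := closure_nonempty_iff.1 ⟨x, hx⟩
        exact ⟨z, hz, by simp⟩
      · obtain ⟨s, rfl⟩ := hcount.exists_eq_range hne
        have hs : ∀ n, s n ∈ 𝒱 := fun n => h𝒮 ⟨n, rfl⟩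
        obtain ⟨z, hzL, hz⟩ := hL.exists_mem_closure hcomp hsemi hx
          (U := fun n => v (s n.unpair.1) n.unpair.2)
          (fun n => (hopen _ (hv _ (hs _) _)).1) fun n => (hopen _ (hv _ (hs _) _)).2
        refine ⟨z, hzL, ?_⟩
        rintro _ ⟨m, rfl⟩
        refine hvV _ (hs m) (Set.mem_iInter.2 fun n => ?_)
        simpa using hz (Nat.pair m n)
    · have hlt : ℵ₀ < #𝒮 := by
        rw [← not_le, Cardinal.le_aleph0_iff_set_countable]
        exact hcount
      obtain ⟨κ, _, _, e, hκ, hmax⟩ := exists_wellOrder_mk_Iio_lt 𝒮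
      have : Infinite 𝒮 := infinite_iff.2 hlt.le
      have : Nonempty κ := ⟨e.symm (Classical.arbitrary 𝒮)⟩
      have := hmax ‹_›
      have he : ∀ β, (e β : Set X) ∈ 𝒱 := fun β => h𝒮 (e β).2
      obtain ⟨y, hyL, hy⟩ := exists_infClosure_image_Ici_subset
        (fun β => ⋂ n, v (e β) n) (fun _ => L) (by
          intro α y hyL hW
          let E : Set X := insert x (infClosure (y '' Set.Iio α))
          let g : κ × ℕ × X → Set X := fun q => (q.2.2 ⊓ ·) ⁻¹' v (e q.1) q.2.1
          have hcard : #↥(𝒱 ∩ g '' (Set.Iic α ×ˢ Set.univ ×ˢ E)) < #𝒮 := by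
            refine ((mk_le_mk_of_subset Set.inter_subset_right).trans mk_image_le).trans_lt ?_
            obtain ⟨γ, hγ⟩ := exists_gt α
            have h1 : #(Set.Iic α) < #𝒮 :=
              (mk_le_mk_of_subset fun β hβ => lt_of_le_of_lt hβ hγ).trans_lt (hκ γ)
            have h2 : #E < #𝒮 := (mk_insert_le (a := x)).trans_lt
              (add_lt_of_lt hlt.le (mk_infClosure_lt hlt (mk_image_le.trans_lt (hκ α)))
                (one_lt_aleph0.trans hlt))
            have h3 : #↥((Set.univ : Set ℕ) ×ˢ E) < #𝒮 := by
              rw [mk_congr (Equiv.Set.prod _ _), mk_prod]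
              simpa using mul_lt_of_lt hlt.le hlt h2
            rw [mk_setProd]
            exact mul_lt_of_lt hlt.le h1 h3
          obtain ⟨p, hpL, hp⟩ := ih _ hcard Set.inter_subset_left rfl
          have key : ∀ β ≤ α, ∀ n, ∀ c ∈ E, c ∈ v (e β) n → c ≤ x → c ⊓ p ∈ v (e β) n :=
            fun β hβ n c hc hcv hcx =>
              hp _ ⟨hinf _ (hv _ (he β) n) c hcv hcx, (β, n, c), ⟨hβ, trivial, hc⟩, rfl⟩
          refine ⟨p, hpL, fun β hβ => ⟨Set.mem_iInter.2 fun n => ?_, fun d hd =>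
            Set.mem_iInter.2 fun n => ?_⟩⟩
          · have := key β hβ n x (Set.mem_insert _ _) (hopen _ (hv _ (he β) n)).2 le_rfl
            rwa [inf_eq_right.2 (hL.le p hpL)] at this
          · have hdL : d ∈ L := infClosure_min (by rintro _ ⟨γ, hγ, rfl⟩; exact hyL γ hγ.2)
              hL.lower.infClosed' hd
            exact key β hβ n d (Set.mem_insert_of_mem _ (infClosure_mono
              (Set.image_mono Set.Ico_subset_Iio_self) hd)) (Set.mem_iInter.1 (hW β hd) n)
              (hL.le d hdL))
      obtain ⟨z, hzL, hz⟩ := hcomp.exists_isOrderLiminf hsemi hL (map y atTop)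
        (Frequently.of_forall (f := atTop) hyL)
      refine ⟨z, hzL, fun V hV => ?_⟩
      obtain ⟨β, hβ⟩ := e.surjective ⟨V, hV⟩
      have hVβ : (e β : Set X) = V := congrArg Subtype.val hβ
      rw [← hVβ]
      refine hvV _ (he β) (Set.mem_iInter.2 fun n => ?_)
      exact hz.mem_of_infClosure_subset hcomp hsemi (image_mem_map (Ici_mem_atTop β))
        isClosed_closure ((hy β).trans ((Set.iInter_subset _ n).trans subset_closure))

theorem T2DeltaSpace.of_regularSpace (Y : Type*) [TopologicalSpace Y] [T3Space Y] :
    T2DeltaSpace Y := by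
  refine ⟨inferInstance, fun U hU y hy => ?_⟩
  obtain ⟨A, hA, hAc, hAU⟩ := exists_mem_nhds_isClosed_subset (hU.mem_nhds hy)
  exact ⟨{A}, Set.countable_singleton A, by simp [hAc, hA], by simpa using hAU⟩

/-- The case of spaces whose points are separated by continuous maps to a T2δ-space. -/
theorem IsLowerChainClosed.mem_of_separated {X : Type u} [SemilatticeInf X] [TopologicalSpace X]
    [T2Space X] {L : Set X} {x : X} (hL : IsLowerChainClosed L x) (hcomp : CompleteTS X)
    (hsemi : ∀ a : X, Continuous fun x => a ⊓ x) (hx : x ∈ closure L)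
    {Y : Type*} [TopologicalSpace Y] (hY : T2DeltaSpace Y)
    (hsep : ∀ x y : X, x ≠ y → ∃ g : X → Y, Continuous g ∧ g x ≠ g y) : x ∈ L := by
  obtain ⟨z, hzL, hz⟩ := hL.exists_forall_mem hcomp hsemi hx
    (𝒱 := {V | ∃ g : X → Y, Continuous g ∧ ∃ U, IsOpen U ∧ V = g ⁻¹' U ∧ x ∈ V})
    (by
      rintro _ ⟨g, hg, U, hU, rfl, hxV⟩
      exact ⟨hU.preimage hg, hxV⟩)
    (by
      rintro _ ⟨g, hg, U, hU, rfl, hxV⟩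
      obtain ⟨𝒰, hcount, h𝒰, hsub⟩ := hY.2 U hU (g x) hxV
      obtain ⟨A, hA⟩ := (hcount.insert Set.univ).exists_eq_range (Set.insert_nonempty _ _)
      have hmem : ∀ n, IsClosed (A n) ∧ A n ∈ 𝓝 (g x) := by
        intro n
        rcases hA.symm.subset ⟨n, rfl⟩ with h | h
        · rw [h]
          exact ⟨isClosed_univ, univ_mem⟩
        · exact h𝒰 _ h
      refine ⟨fun n => g ⁻¹' interior (A n), fun n => ⟨g, hg, _, isOpen_interior, rfl,
        mem_interior_iff_mem_nhds.2 (hmem n).2⟩, fun p hp => hsub fun B hB => ?_⟩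
      obtain ⟨n, rfl⟩ := hA.subset (Set.mem_insert_of_mem _ hB)
      exact closure_minimal (Set.preimage_mono interior_subset) ((hmem n).1.preimage hg)
        (Set.mem_iInter.1 hp n))
    (by
      rintro _ ⟨g, hg, U, hU, rfl, hxV⟩ e he hex
      refine ⟨fun p => g (e ⊓ p), hg.comp (hsemi e), U, hU, rfl, ?_⟩
      simpa [inf_eq_left.2 hex] using he) subset_rfl
  suffices z = x by rwa [← this]
  by_contra hne
  obtain ⟨g, hg, hgx⟩ := hsep z x hne
  have := hY.1
  exact hz (g ⁻¹' {g z}ᶜ) ⟨g, hg, _, isOpen_compl_singleton, rfl, hgx.symm⟩ rfl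

theorem CompleteTS.isClosed_compl_of_scottOpen {X : Type u} [SemilatticeInf X] [TopologicalSpace X]
    [T2Space X] (hcomp : CompleteTS X) (hsemi : ∀ a : X, Continuous fun x => a ⊓ x)
    (hcond : (Continuous fun p : X × X => p.1 ⊓ p.2) ∨
      SequentialSpace X ∨
      (∃ (Y : Type u) (tY : TopologicalSpace Y) (f : X → Y),
        @T2DeltaSpace Y tY ∧ Function.Injective f ∧ @Continuous X Y _ tY f) ∨
      (∀ x y : X, x ≠ y → ∃ f : X → ℝ, Continuous f ∧ f x ≠ f y))
    {U : Set X} (hU : ScottOpen X U) : IsClosed Uᶜ := by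
  have hlower : IsLowerSet Uᶜ := hU.1.compl
  have hL : ∀ x, IsLowerChainClosed (Uᶜ ∩ Set.Iic x) x := fun x =>
    { lower := hlower.inter (isLowerSet_Iic x)
      chain := by
        intro T hT hne hchain
        obtain ⟨b, hb, -⟩ := (hcomp T hne hchain).2
        refine ⟨b, ⟨fun hbU => ?_, hb.2 fun t ht => (hT ht).2⟩, hb⟩
        obtain ⟨t, ht, htU⟩ := hU.2 T hne hchain.directedOn b hb hbU
        exact (hT ht).1 htU
      le := fun a ha => ha.2 }
  have hmaps : ∀ x, Set.MapsTo (x ⊓ ·) Uᶜ (Uᶜ ∩ Set.Iic x) := fun x a ha =>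
    ⟨hlower inf_le_right ha, inf_le_left⟩
  have hclosure : ∀ x ∈ closure Uᶜ, x ∈ closure (Uᶜ ∩ Set.Iic x) := fun x hx => by
    simpa using map_mem_closure (hsemi x) hx (hmaps x)
  rcases hcond with h | h | ⟨Y, _, f, hY, hf, hfc⟩ | h
  · exact isClosed_of_closure_subset fun x hx =>
      ((hL x).mem_of_continuous_inf hcomp h (hclosure x hx)).1
  · refine IsSeqClosed.isClosed fun s x hs hx => ?_
    refine ((hL x).mem_of_tendsto hcomp hsemi (u := fun n => x ⊓ s n) (fun n => hmaps x (hs n)) ?_).1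
    simpa [Function.comp_def] using ((hsemi x).tendsto x).comp hx
  · exact isClosed_of_closure_subset fun x hx =>
      ((hL x).mem_of_separated hcomp hsemi (hclosure x hx) hY fun a b hab =>
        ⟨f, hfc, hf.ne hab⟩).1
  · exact isClosed_of_closure_subset fun x hx =>
      ((hL x).mem_of_separated hcomp hsemi (hclosure x hx) (.of_regularSpace ℝ) h).1

theorem CompleteTS.scottOpen_of_isClosed_compl {X : Type*} [SemilatticeInf X] [TopologicalSpace X]
    (hcomp : CompleteTS X) {U : Set X} (hU : IsUpperSet U) (hc : IsClosed Uᶜ) : ScottOpen X U := by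
  refine ⟨hU, fun D hne hD a ha haU => ?_⟩
  by_contra h
  obtain ⟨b, hb, hDb⟩ := DirectedOn.exists_isLUB_mem_of_chain (hcomp.exists_isLUB_mem hc)
    (fun d hd hdU => h ⟨d, hd, hdU⟩) hne hD
  exact hb (ha.unique hDb ▸ haU)

end Topology

/-- Let `X` be a complete Hausdorff semitopological semilattice with topology
`τ_X`, satisfying at least one of: (1) `(x,y) ↦ x ⊓ y` is jointly continuous; (2) `X` is
sequential; (3) `X` admits an injective continuous map to a T2δ-space; (4) `X` is
functionally Hausdorff. Then `𝒲_X ⊆ Λ_X ⊆ 𝒵_X ⊆ τ_X`. -/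
theorem stmt13 {X : Type u} [SemilatticeInf X] [TopologicalSpace X] [T2Space X]
    (hsemi : ∀ a : X, Continuous fun x => a ⊓ x)
    (hcomp : CompleteTS X)
    (hcond : (Continuous fun p : X × X => p.1 ⊓ p.2) ∨
      SequentialSpace X ∨
      (∃ (Y : Type u) (tY : TopologicalSpace Y) (f : X → Y),
        @T2DeltaSpace Y tY ∧ Function.Injective f ∧ @Continuous X Y _ tY f) ∨
      (∀ x y : X, x ≠ y → ∃ f : X → ℝ, Continuous f ∧ f x ≠ f y)) :
    (∀ U : Set X, @IsOpen X (iweakTop X) U → @IsOpen X (lawsonTop X) U) ∧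
    (∀ U : Set X, @IsOpen X (lawsonTop X) U → @IsOpen X (zarTop X) U) ∧
    (∀ U : Set X, @IsOpen X (zarTop X) U → IsOpen U) := by
  refine ⟨?_, ?_, ?_⟩
  · suffices h : lawsonTop X ≤ iweakTop X from h
    refine le_generateFrom ?_
    rintro _ ⟨h, hc, hinf, U, hU, rfl⟩
    have hmono : Monotone h := fun a b hab => by
      rw [← inf_eq_left.2 hab, hinf]
      exact min_le_right _ _
    have hIoi : ∀ a, @IsOpen X (lawsonTop X) (h ⁻¹' Ioi a) := fun a => by
      refine isOpen_generateFrom_of_mem (Or.inl (hcomp.scottOpen_of_isClosed_compl ?_ ?_))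
      · exact fun p q hpq hp => lt_of_lt_of_le hp (hmono hpq)
      · exact (isOpen_Ioi.preimage hc).isClosed_compl
    have hIio : ∀ a, @IsOpen X (lawsonTop X) (h ⁻¹' Iio a) := fun a => by
      rcases (h ⁻¹' Ici a).eq_empty_or_nonempty with hempty | hne
      · rw [← compl_Ici, preimage_compl, hempty, compl_empty]
        exact @isOpen_univ X (lawsonTop X)
      · obtain ⟨m, hm⟩ := hcomp.exists_isLeast (isClosed_Ici.preimage hc)
          (fun p hp q hq => (le_min hp hq).trans_eq (hinf p q).symm) hne
        refine isOpen_generateFrom_of_mem (Or.inr ⟨m, ?_⟩)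
        rw [← compl_Ici, preimage_compl]
        exact congrArg _ (Subset.antisymm (fun p hp => hm.2 hp) fun p hp => hm.1.trans (hmono hp))
    exact @IsOpen.preimage _ _ (lawsonTop X) _ _
      ((@OrderTopology.continuous_iff _ _ _ _ inferInstance (lawsonTop X) _).2
        fun a => ⟨hIoi a, hIio a⟩) U hU
  · suffices h : zarTop X ≤ lawsonTop X from h
    refine le_generateFrom ?_
    rintro U (hU | ⟨x, rfl⟩)
    · refine isOpen_generateFrom_of_mem ⟨Uᶜ, hcomp.isClosed_compl_of_scottOpen hsemi hcond hU,
        fun a ha b _ => hU.1.compl inf_le_left ha, (compl_compl U).symm⟩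
    · exact isOpen_generateFrom_of_mem ⟨Ici x, isClosed_Ici_of_continuous_inf hsemi x,
        fun a ha b hb => le_inf ha hb, rfl⟩
  · suffices h : ‹TopologicalSpace X› ≤ zarTop X from h
    refine le_generateFrom ?_
    rintro _ ⟨S, hS, -, rfl⟩
    exact hS.isOpen_compl
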